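/- arXiv:2601.12172 — 5 statements merged into one kernel-verified Lean document; each statement's English description precedes it below -/
import Mathlib

section
/- For any disjoint sets A, B ⊆ {1,…,n}, the events of pairwise non-coalescence satisfy the set identity I_A(N) ∩ I_B(N) = I_A(N) □ I_B(N). -/
/-!  The events of pairwise non-coalescence until time `N` satisfy
`I_A(N) ∩ I_B(N) = I_A(N) □ I_B(N)` for disjoint `A, B ⊆ {1,…,n}`. -/

/-- The two possible steps, `true ↦ (1,0)` and `false ↦ (0,1)`. -/
def webStep (b : Bool) : ℕ × ℕ := if b then (1, 0) else (0, 1)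

/-- One step of a walk in the environment `ω`. -/
def webNext (ω : (ℕ × ℕ) → Bool) (p : ℕ × ℕ) : ℕ × ℕ := p + webStep (ω p)

/-- `‖λ‖`, the sum of the coordinates of `λ ∈ Λ = ℕ × ℕ`. -/
def webNorm (p : ℕ × ℕ) : ℕ := p.1 + p.2

/-- The coalescing walk started from `lam`, evaluated at universal time `n`. -/
def webWalk (ω : (ℕ × ℕ) → Bool) (lam : ℕ × ℕ) (n : ℕ) : ℕ × ℕ :=
  (webNext ω)^[n - webNorm lam] lam

/-- `τ_{λ₁,λ₂}(N) < ∞` : the walks started at `l₁`, `l₂` meet at some time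
`max (‖l₁‖, ‖l₂‖) ≤ k ≤ N`. -/
def MeetBy (ω : (ℕ × ℕ) → Bool) (l₁ l₂ : ℕ × ℕ) (N : ℕ) : Prop :=
  ∃ k, max (webNorm l₁) (webNorm l₂) ≤ k ∧ k ≤ N ∧ webWalk ω l₁ k = webWalk ω l₂ k

/-- `Λ_N`, the points of norm at most `N`. -/
def LambdaN (N : ℕ) : Set (ℕ × ℕ) := {p | webNorm p ≤ N}

/-- `[ω]_K`, the set of environments agreeing with `ω` on `K`. -/
def cylEq (ω : (ℕ × ℕ) → Bool) (K : Set (ℕ × ℕ)) : Set ((ℕ × ℕ) → Bool) :=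
  {ω' | ∀ p ∈ K, ω' p = ω p}

/-- The van den Berg–Kesten box operation `A □ B` (relative to `Λ_N`): the events `A`
and `B` can be tested on disjoint subsets of `Λ_N`. -/
def boxOp (N : ℕ) (A B : Set ((ℕ × ℕ) → Bool)) : Set ((ℕ × ℕ) → Bool) :=
  {ω | ∃ K L : Set (ℕ × ℕ), K ⊆ LambdaN N ∧ L ⊆ LambdaN N ∧ Disjoint K L ∧
        cylEq ω K ⊆ A ∧ cylEq ω L ⊆ B}

/-- The event `I_j(N) = {τ_{λ_j, λ_{j-1}}(N) = ∞}` where `λ_j = (j, n - j)`. -/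
def IEvent (n N j : ℕ) : Set ((ℕ × ℕ) → Bool) :=
  {ω | ¬ MeetBy ω (j, n - j) (j - 1, n - (j - 1)) N}

theorem webNorm_webNext (ω : (ℕ × ℕ) → Bool) (p : ℕ × ℕ) :
    webNorm (webNext ω p) = webNorm p + 1 := by
  cases h : ω p <;> simp [webNorm, webNext, webStep, h] <;> omega

theorem webNorm_iterate_webNext (ω : (ℕ × ℕ) → Bool) (p : ℕ × ℕ) (t : ℕ) :
    webNorm ((webNext ω)^[t] p) = webNorm p + t := by
  induction t with
  | zero => rfl
  | succ t ih => rw [Function.iterate_succ_apply', webNorm_webNext, ih, Nat.add_assoc]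

theorem webNext_fst (ω : (ℕ × ℕ) → Bool) (p : ℕ × ℕ) :
    (webNext ω p).1 = p.1 + if ω p then 1 else 0 := by
  cases h : ω p <;> simp [webNext, webStep, h]

theorem eq_of_fst_eq_of_webNorm_eq {p q : ℕ × ℕ} (h : p.1 = q.1)
    (hn : webNorm p = webNorm q) : p = q := by
  unfold webNorm at hn
  exact Prod.ext h (by omega)

/-- One step preserves the order of two walks in different environments, provided the two
environments are ordered wherever the walks are at the same site. -/
theorem webNext_fst_le {ω ω' : (ℕ × ℕ) → Bool} {p q : ℕ × ℕ}
    (hn : webNorm p = webNorm q) (hpq : p.1 ≤ q.1)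
    (h : p = q → ω p = true → ω' q = true) :
    (webNext ω p).1 ≤ (webNext ω' q).1 := by
  rw [webNext_fst, webNext_fst]
  rcases hpq.lt_or_eq with hlt | heq
  · split_ifs <;> omega
  · have := h (eq_of_fst_eq_of_webNorm_eq heq hn)
    split_ifs <;> simp_all

theorem iterate_webNext_fst_le {ω ω' : (ℕ × ℕ) → Bool} {p q : ℕ × ℕ}
    (hn : webNorm p = webNorm q) (hpq : p.1 ≤ q.1) (t : ℕ)
    (h : ∀ s < t, (webNext ω)^[s] p = (webNext ω')^[s] q →
      ω ((webNext ω)^[s] p) = true → ω' ((webNext ω')^[s] q) = true) :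
    ((webNext ω)^[t] p).1 ≤ ((webNext ω')^[t] q).1 := by
  induction t with
  | zero => exact hpq
  | succ t ih =>
    rw [Function.iterate_succ_apply', Function.iterate_succ_apply']
    refine webNext_fst_le ?_ (ih fun s hs => h s (by omega)) (h t (by omega))
    rw [webNorm_iterate_webNext, webNorm_iterate_webNext, hn]

/-- The position after `t` steps of the walk started at `λ_j = (j, n - j)`. -/
def antidiagWalk (ω : (ℕ × ℕ) → Bool) (n j t : ℕ) : ℕ × ℕ := (webNext ω)^[t] (j, n - j)

theorem webNorm_antidiag {n j : ℕ} (hj : j ≤ n) : webNorm (j, n - j) = n := by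
  simp only [webNorm]; omega

theorem webNorm_antidiagWalk (ω : (ℕ × ℕ) → Bool) {n j : ℕ} (hj : j ≤ n) (t : ℕ) :
    webNorm (antidiagWalk ω n j t) = n + t := by
  rw [antidiagWalk, webNorm_iterate_webNext, webNorm_antidiag hj]

theorem antidiagWalk_fst_mono (ω : (ℕ × ℕ) → Bool) {n i j : ℕ} (hij : i ≤ j) (hj : j ≤ n)
    (t : ℕ) : (antidiagWalk ω n i t).1 ≤ (antidiagWalk ω n j t).1 := by
  refine iterate_webNext_fst_le ?_ hij t fun s _ h hω => h ▸ hω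
  rw [webNorm_antidiag hj, webNorm_antidiag (hij.trans hj)]

theorem mem_IEvent_iff {ω : (ℕ × ℕ) → Bool} {n N j : ℕ} (hj : j ≤ n) :
    ω ∈ IEvent n N j ↔
      ∀ t, n + t ≤ N → (antidiagWalk ω n (j - 1) t).1 < (antidiagWalk ω n j t).1 := by
  have hj' : j - 1 ≤ n := by omega
  simp only [IEvent, MeetBy, Set.mem_ofPred_eq, webWalk, webNorm_antidiag hj,
    webNorm_antidiag hj', max_self]
  constructor
  · intro h t ht
    refine lt_of_le_of_ne (antidiagWalk_fst_mono ω (Nat.sub_le j 1) hj t) fun heq => ?_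
    refine h ⟨n + t, by omega, ht, ?_⟩
    rw [Nat.add_sub_cancel_left]
    refine (eq_of_fst_eq_of_webNorm_eq heq ?_).symm
    rw [webNorm_antidiagWalk ω hj, webNorm_antidiagWalk ω hj']
  · rintro h ⟨k, hk, hkN, heq⟩
    have hlt := h (k - n) (by omega)
    simp only [antidiagWalk, heq, lt_irrefl] at hlt

/-- The sites witnessing that the walks from `λ_{j-1}` and `λ_j`, `j ∈ C`, do not meet: those
where the walk from `λ_{j-1}` steps up, and those where the walk from `λ_j` steps right. -/
def gapWitness (ω : (ℕ × ℕ) → Bool) (n N : ℕ) (C : Finset ℕ) : Set (ℕ × ℕ) :=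
  {p | webNorm p ≤ N ∧ ∃ j ∈ C, ∃ t, (antidiagWalk ω n (j - 1) t = p ∧ ω p = false) ∨
    (antidiagWalk ω n j t = p ∧ ω p = true)}

theorem cylEq_gapWitness_subset {ω : (ℕ × ℕ) → Bool} {n N : ℕ} {C : Finset ℕ}
    (hC : C ⊆ Finset.Icc 1 n) (hω : ω ∈ ⋂ j ∈ C, IEvent n N j) :
    cylEq ω (gapWitness ω n N C) ⊆ ⋂ j ∈ C, IEvent n N j := by
  intro ω' hω'
  simp only [Set.mem_iInter] at hω ⊢
  intro j hjC
  have hj : j ≤ n := (Finset.mem_Icc.1 (hC hjC)).2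
  have hj' : j - 1 ≤ n := by omega
  refine (mem_IEvent_iff hj).2 fun t ht => ?_
  have hleft : (antidiagWalk ω' n (j - 1) t).1 ≤ (antidiagWalk ω n (j - 1) t).1 := by
    refine iterate_webNext_fst_le rfl le_rfl t fun s hs heq htrue => ?_
    by_contra hfalse
    rw [Bool.not_eq_true] at hfalse
    have hmem : antidiagWalk ω n (j - 1) s ∈ gapWitness ω n N C :=
      ⟨by rw [webNorm_antidiagWalk ω hj']; omega, j, hjC, s, Or.inl ⟨rfl, hfalse⟩⟩
    have hagree : ω' ((webNext ω)^[s] (j - 1, n - (j - 1))) = _ := hω' _ hmem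
    rw [heq, hagree] at htrue
    exact absurd (htrue.symm.trans hfalse) (by simp)
  have hright : (antidiagWalk ω n j t).1 ≤ (antidiagWalk ω' n j t).1 := by
    refine iterate_webNext_fst_le rfl le_rfl t fun s hs heq htrue => ?_
    have hmem : antidiagWalk ω n j s ∈ gapWitness ω n N C :=
      ⟨by rw [webNorm_antidiagWalk ω hj]; omega, j, hjC, s, Or.inr ⟨rfl, htrue⟩⟩
    rw [← heq]
    exact (hω' _ hmem).trans htrue
  exact hleft.trans_lt (((mem_IEvent_iff hj).1 (hω j hjC) t ht).trans_le hright)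

/-- A site is a witness for at most one of the gaps that stay open. -/
theorem gapWitness_index_unique {ω : (ℕ × ℕ) → Bool} {n N i j s t : ℕ} {p : ℕ × ℕ}
    (hij : i < j) (hj : j ≤ n) (hp : webNorm p ≤ N)
    (hωi : ω ∈ IEvent n N i) (hωj : ω ∈ IEvent n N j)
    (hi' : (antidiagWalk ω n (i - 1) s = p ∧ ω p = false) ∨
      (antidiagWalk ω n i s = p ∧ ω p = true))
    (hj' : (antidiagWalk ω n (j - 1) t = p ∧ ω p = false) ∨
      (antidiagWalk ω n j t = p ∧ ω p = true)) : False := by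
  have hs : webNorm p = n + s := by
    rcases hi' with ⟨rfl, -⟩ | ⟨rfl, -⟩ <;> exact webNorm_antidiagWalk ω (by omega) s
  have ht : webNorm p = n + t := by
    rcases hj' with ⟨rfl, -⟩ | ⟨rfl, -⟩ <;> exact webNorm_antidiagWalk ω (by omega) t
  obtain rfl : s = t := by omega
  have h₁ := (mem_IEvent_iff (by omega)).1 hωi s (by omega)
  have h₂ := antidiagWalk_fst_mono ω (n := n) (i := i) (j := j - 1) (by omega) (by omega) s
  have h₃ := (mem_IEvent_iff hj).1 hωj s (by omega)
  rcases hi' with ⟨h, hb⟩ | ⟨h, hb⟩ <;> rcases hj' with ⟨h', hb'⟩ | ⟨h', hb'⟩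
  · rw [h] at h₁; rw [h'] at h₂; omega
  · simp [hb] at hb'
  · simp [hb] at hb'
  · rw [h] at h₂; rw [h'] at h₃; omega

theorem disjoint_gapWitness {ω : (ℕ × ℕ) → Bool} {n N : ℕ} {A B : Finset ℕ}
    (hA : A ⊆ Finset.Icc 1 n) (hB : B ⊆ Finset.Icc 1 n) (hAB : Disjoint A B)
    (hωA : ω ∈ ⋂ j ∈ A, IEvent n N j) (hωB : ω ∈ ⋂ j ∈ B, IEvent n N j) :
    Disjoint (gapWitness ω n N A) (gapWitness ω n N B) := by
  simp only [Set.mem_iInter] at hωA hωB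
  refine Set.disjoint_left.2 ?_
  rintro p ⟨hp, i, hi, s, hs⟩ ⟨-, j, hj, t, ht⟩
  have hin := (Finset.mem_Icc.1 (hA hi)).2
  have hjn := (Finset.mem_Icc.1 (hB hj)).2
  rcases lt_trichotomy i j with h | rfl | h
  · exact gapWitness_index_unique h hjn hp (hωA i hi) (hωB j hj) hs ht
  · exact Finset.disjoint_left.1 hAB hi hj
  · exact gapWitness_index_unique h hin hp (hωB j hj) (hωA i hi) ht hs

/-- For disjoint `A, B ⊆ {1,…,n}` (with `1 ≤ n ≤ N`),
`I_A(N) ∩ I_B(N) = I_A(N) □ I_B(N)`. -/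
theorem inter_eq_boxOp (n N : ℕ) (hn : 1 ≤ n) (hN : n ≤ N)
    (A B : Finset ℕ) (hA : A ⊆ Finset.Icc 1 n) (hB : B ⊆ Finset.Icc 1 n)
    (hAB : Disjoint A B) :
    (⋂ j ∈ A, IEvent n N j) ∩ (⋂ j ∈ B, IEvent n N j) =
      boxOp N (⋂ j ∈ A, IEvent n N j) (⋂ j ∈ B, IEvent n N j) := by
  refine Set.Subset.antisymm ?_ ?_
  · rintro ω ⟨hωA, hωB⟩
    exact ⟨gapWitness ω n N A, gapWitness ω n N B, fun _ hp => hp.1, fun _ hp => hp.1,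
      disjoint_gapWitness hA hB hAB hωA hωB, cylEq_gapWitness_subset hA hωA,
      cylEq_gapWitness_subset hB hωB⟩
  · rintro ω ⟨K, L, -, -, -, hK, hL⟩
    exact ⟨hK fun _ _ => rfl, hL fun _ _ => rfl⟩
end

section
/- Let X₁, X₂, … be {0,1}-valued random variables such that for each n the variables X₁,…,X_n are negatively associated, and let S_n = X₁ + ⋯ + X_n. If there exist constants C, c > 0 such that E[S_n] ≥ C·n^c·(1+o(1)) as n → ∞, then S_n / E[S_n] → 1 almost surely. -/
open MeasureTheory ProbabilityTheory Filter

/-- The random variables `X 0, …, X (n-1)` are negatively associated: for all disjoint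
index sets `A, B` and all (bounded measurable) functions `f`, `g` depending only on the
coordinates in `A` resp. `B` which are both monotone increasing or both monotone
decreasing, `E[f(X)·g(X)] ≤ E[f(X)]·E[g(X)]`. -/
def NegAssoc {Om : Type*} [MeasurableSpace Om] (μ : Measure Om) {n : ℕ}
    (X : Fin n → Om → ℝ) : Prop :=
  ∀ A B : Finset (Fin n), Disjoint A B →
    ∀ f g : (Fin n → ℝ) → ℝ, Measurable f → Measurable g →
      (∃ M, ∀ x, |f x| ≤ M) → (∃ M, ∀ x, |g x| ≤ M) →
      (∀ x y, (∀ i ∈ A, x i = y i) → f x = f y) →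
      (∀ x y, (∀ i ∈ B, x i = y i) → g x = g y) →
      ((Monotone f ∧ Monotone g) ∨ (Antitone f ∧ Antitone g)) →
      ∫ ω, f (fun i => X i ω) * g (fun i => X i ω) ∂μ ≤
        (∫ ω, f (fun i => X i ω) ∂μ) * ∫ ω, g (fun i => X i ω) ∂μ

/-- Nonnegative integrable functions with summable integrals tend to zero almost everywhere. -/
theorem ae_tendsto_zero_of_summable_integral {Om : Type*} [MeasurableSpace Om] {μ : Measure Om}
    {Y : ℕ → Om → ℝ} (hY : ∀ k, Integrable (Y k) μ) (h0 : ∀ k ω, 0 ≤ Y k ω)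
    (hs : Summable fun k => ∫ ω, Y k ω ∂μ) :
    ∀ᵐ ω ∂μ, Tendsto (fun k => Y k ω) atTop (nhds 0) := by
  have hmeas : ∀ k, AEMeasurable (fun ω => ENNReal.ofReal (Y k ω)) μ := fun k =>
    (hY k).aemeasurable.ennreal_ofReal
  have hfin : ∫⁻ ω, ∑' k, ENNReal.ofReal (Y k ω) ∂μ ≠ ⊤ := by
    rw [lintegral_tsum hmeas]
    simp_rw [← fun k => ofReal_integral_eq_lintegral_ofReal (hY k) (ae_of_all _ (h0 k))]
    exact hs.tsum_ofReal_ne_top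
  filter_upwards [ae_lt_top' (AEMeasurable.tsum hmeas) hfin] with ω hω
  have h := ENNReal.tendsto_atTop_zero_of_tsum_ne_top hω.ne
  have h' := (ENNReal.tendsto_toReal ENNReal.zero_ne_top).comp h
  simpa [Function.comp_def, ENNReal.toReal_ofReal (h0 _ ω)] using h'

/-- If `t k` is the first index at which `m` reaches `k ^ 2`, convergence of `s / m` follows from
convergence of `s (t k) / k ^ 2`. -/
theorem tendsto_div_of_tendsto_subseq_div_sq {s m : ℕ → ℝ} {t : ℕ → ℕ} (hs : Monotone s)
    (hs0 : ∀ n, 0 ≤ s n) (hm : Monotone m) (hm0 : ∀ n, 0 ≤ m n) (hmt : Tendsto m atTop atTop)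
    (ht : ∀ k : ℕ, (k : ℝ) ^ 2 ≤ m (t k)) (ht' : ∀ k n : ℕ, (k : ℝ) ^ 2 ≤ m n → t k ≤ n)
    (h : Tendsto (fun k : ℕ => s (t k) / (k : ℝ) ^ 2) atTop (nhds 1)) :
    Tendsto (fun n => s n / m n) atTop (nhds 1) := by
  have hk : Tendsto (fun n => ⌊√(m n)⌋₊) atTop atTop :=
    tendsto_nat_floor_atTop.comp (Real.tendsto_sqrt_atTop.comp hmt)
  have hratio : Tendsto (fun k : ℕ => (k : ℝ) / ((k : ℝ) + 1)) atTop (nhds 1) :=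
    tendsto_natCast_div_add_atTop 1
  have hlow : Tendsto (fun k : ℕ => s (t k) / ((k : ℝ) + 1) ^ 2) atTop (nhds 1) := by
    have := h.mul (hratio.pow 2)
    simp only [one_pow, mul_one] at this
    refine this.congr' ?_
    filter_upwards [eventually_gt_atTop 0] with k hk0
    have : (0 : ℝ) < k := by exact_mod_cast hk0
    field_simp
  have hupp : Tendsto (fun k : ℕ => s (t (k + 1)) / (k : ℝ) ^ 2) atTop (nhds 1) := by
    have := ((tendsto_add_atTop_iff_nat 1).2 h).div (hratio.pow 2) (by norm_num)
    simp only [one_pow, div_one] at this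
    refine this.congr' ?_
    filter_upwards [eventually_gt_atTop 0] with k hk0
    have : (0 : ℝ) < k := by exact_mod_cast hk0
    simp only [Pi.div_apply]
    push_cast
    field_simp
  refine tendsto_of_tendsto_of_tendsto_of_le_of_le' (hlow.comp hk) (hupp.comp hk) ?_ ?_
  all_goals
    filter_upwards [hmt.eventually_gt_atTop 0, hk.eventually_gt_atTop 0] with n hn hkn
    have hfl : ((⌊√(m n)⌋₊ : ℕ) : ℝ) ^ 2 ≤ m n := by
      calc _ ≤ √(m n) ^ 2 := by gcongr; exact Nat.floor_le (Real.sqrt_nonneg _)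
        _ = m n := Real.sq_sqrt (hm0 n)
    have hfu : m n < ((⌊√(m n)⌋₊ : ℕ) + 1 : ℝ) ^ 2 := by
      calc m n = √(m n) ^ 2 := (Real.sq_sqrt (hm0 n)).symm
        _ < _ := by gcongr; exact Nat.lt_floor_add_one _
    have hkn' : (0 : ℝ) < (⌊√(m n)⌋₊ : ℕ) := by exact_mod_cast hkn
    simp only [Function.comp_apply]
  · exact div_le_div₀ (hs0 n) (hs (ht' _ _ hfl)) hn hfu.le
  · refine div_le_div₀ (hs0 _) (hs ?_) (by positivity) hfl
    by_contra! hlt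
    have h1 := ht (⌊√(m n)⌋₊ + 1)
    push_cast at h1
    linarith [hm hlt.le]

/-- Distinct members of a negatively associated `{0, 1}`-valued family have nonpositive
covariance. -/
theorem NegAssoc.integral_mul_le {Om : Type*} [MeasurableSpace Om] {μ : Measure Om} {n : ℕ}
    {X : Fin n → Om → ℝ} (hNA : NegAssoc μ X) (h01 : ∀ i ω, X i ω = 0 ∨ X i ω = 1)
    {i j : Fin n} (hij : i ≠ j) :
    ∫ ω, X i ω * X j ω ∂μ ≤ (∫ ω, X i ω ∂μ) * ∫ ω, X j ω ∂μ := by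
  have hX : ∀ l ω, max 0 (min 1 (X l ω)) = X l ω := by
    intro l ω
    rcases h01 l ω with h | h <;> simp [h]
  have hmeas : ∀ l : Fin n, Measurable fun x : Fin n → ℝ => max 0 (min 1 (x l)) := by
    intro l
    fun_prop
  have hbdd : ∀ l : Fin n, ∃ M, ∀ x : Fin n → ℝ, |max 0 (min 1 (x l))| ≤ M := by
    refine fun l => ⟨1, fun x => ?_⟩
    rw [abs_of_nonneg (le_max_left _ _)]
    exact max_le zero_le_one (min_le_left _ _)
  have hmono : ∀ l : Fin n, Monotone fun x : Fin n → ℝ => max 0 (min 1 (x l)) :=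
    fun l x y hxy => max_le_max le_rfl (min_le_min le_rfl (hxy l))
  have h := hNA {i} {j} (by simpa using hij) _ _ (hmeas i) (hmeas j) (hbdd i) (hbdd j)
    (fun x y hxy => by simp only [hxy i (Finset.mem_singleton_self i)])
    (fun x y hxy => by simp only [hxy j (Finset.mem_singleton_self j)])
    (Or.inl ⟨hmono i, hmono j⟩)
  simpa only [hX] using h

theorem memLp_of_zero_or_one {Om : Type*} [MeasurableSpace Om] {μ : Measure Om}
    [IsFiniteMeasure μ] {Y : Om → ℝ} (hY : Measurable Y) (h01 : ∀ ω, Y ω = 0 ∨ Y ω = 1)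
    (p : ENNReal) : MemLp Y p μ :=
  MemLp.of_bound hY.aestronglyMeasurable 1
    (ae_of_all _ fun ω => by rcases h01 ω with h | h <;> simp [h])

/-- The variance of a sum of pairwise nonpositively correlated `{0, 1}`-valued random variables
is at most its mean. -/
theorem variance_sum_le_integral_sum {Om ι : Type*} [MeasurableSpace Om] {μ : Measure Om}
    [IsProbabilityMeasure μ] {X : ι → Om → ℝ} (hmeas : ∀ i, Measurable (X i))
    (h01 : ∀ i ω, X i ω = 0 ∨ X i ω = 1) {s : Finset ι}
    (hcov : ∀ i ∈ s, ∀ j ∈ s, i ≠ j →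
      ∫ ω, X i ω * X j ω ∂μ ≤ (∫ ω, X i ω ∂μ) * ∫ ω, X j ω ∂μ) :
    Var[fun ω => ∑ i ∈ s, X i ω; μ] ≤ ∫ ω, ∑ i ∈ s, X i ω ∂μ := by
  classical
  have hLp := fun i => memLp_of_zero_or_one (μ := μ) (hmeas i) (h01 i) 2
  rw [variance_fun_sum' fun i _ => hLp i,
    integral_finsetSum _ fun i _ => (hLp i).integrable (by norm_num)]
  refine Finset.sum_le_sum fun i hi => ?_
  have hle : ∀ j ∈ s, cov[X i, X j; μ] ≤ if i = j then ∫ ω, X i ω ∂μ else 0 := by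
    intro j hj
    rw [covariance_eq_sub (hLp i) (hLp j)]
    split_ifs with hij
    · subst hij
      have : (X i * X i) = X i := by
        ext ω
        rcases h01 i ω with h | h <;> simp [h]
      rw [this]
      nlinarith [mul_self_nonneg (∫ ω, X i ω ∂μ)]
    · exact sub_nonpos.2 (hcov i hi j hj hij)
  calc _ ≤ _ := Finset.sum_le_sum hle
    _ = _ := by simp [hi]

/-- Let `X 1, X 2, …` be `{0,1}`-valued random variables such that for
each `n` the variables `X 1, …, X n` are negatively associated, and let
`S n = X 1 + ⋯ + X n`.  If `E[S n] ≥ C·n^c·(1 + o(1))` for some constants `C, c > 0`,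
then `S n / E[S n] → 1` almost surely. -/
theorem negAssoc_sum_div_mean_tendsto_one
    {Om : Type*} [MeasurableSpace Om] (μ : Measure Om) [IsProbabilityMeasure μ]
    (X : ℕ → Om → ℝ) (hmeas : ∀ i, Measurable (X i))
    (h01 : ∀ i ω, X i ω = 0 ∨ X i ω = 1)
    (hNA : ∀ n : ℕ, NegAssoc μ (fun i : Fin n => X (i.val + 1)))
    (C c : ℝ) (hC : 0 < C) (hc : 0 < c) (e : ℕ → ℝ) (he : Tendsto e atTop (nhds 0))
    (hE : ∀ n : ℕ, C * (n : ℝ) ^ c * (1 + e n) ≤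
      ∫ ω, (∑ i ∈ Finset.Icc 1 n, X i ω) ∂μ) :
    ∀ᵐ ω ∂μ, Tendsto
      (fun n : ℕ => (∑ i ∈ Finset.Icc 1 n, X i ω) /
        ∫ ω', (∑ i ∈ Finset.Icc 1 n, X i ω') ∂μ)
      atTop (nhds 1) := by
  set S : ℕ → Om → ℝ := fun n ω => ∑ i ∈ Finset.Icc 1 n, X i ω with hS
  set m : ℕ → ℝ := fun n => ∫ ω, S n ω ∂μ with hm
  have hX0 : ∀ i ω, 0 ≤ X i ω := fun i ω => by rcases h01 i ω with h | h <;> simp [h]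
  have hX1 : ∀ i ω, X i ω ≤ 1 := fun i ω => by rcases h01 i ω with h | h <;> simp [h]
  have hS0 : ∀ n ω, 0 ≤ S n ω := fun n ω => Finset.sum_nonneg fun i _ => hX0 i ω
  have hSLp : ∀ n, MemLp (S n) 2 μ := fun n =>
    memLp_finsetSum _ fun i _ => memLp_of_zero_or_one (hmeas i) (h01 i) 2
  have hSint : ∀ n, Integrable (S n) μ := fun n => (hSLp n).integrable (by norm_num)
  have hSsucc : ∀ n ω, S (n + 1) ω = S n ω + X (n + 1) ω := fun n ω =>
    Finset.sum_Icc_succ_top (by omega) _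
  have hSmono : ∀ ω, Monotone fun n => S n ω := fun ω =>
    monotone_nat_of_le_succ fun n => by linarith [hSsucc n ω, hX0 (n + 1) ω]
  have hm0 : ∀ n, 0 ≤ m n := fun n => integral_nonneg (hS0 n)
  have hmmono : Monotone m := fun a b hab =>
    integral_mono (hSint a) (hSint b) fun ω => hSmono ω hab
  have hmsucc : ∀ n, m (n + 1) ≤ m n + 1 := by
    intro n
    calc m (n + 1) ≤ ∫ ω, (S n ω + 1) ∂μ :=
          integral_mono (hSint _) ((hSint n).add (integrable_const 1)) fun ω => by
            simp only [hSsucc]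
            linarith [hX1 (n + 1) ω]
      _ = m n + 1 := by rw [integral_add (hSint n) (integrable_const 1)]; simp [hm]
  have hmt : Tendsto m atTop atTop := by
    refine tendsto_atTop_mono hE ?_
    have h1 : Tendsto (fun n : ℕ => C * (n : ℝ) ^ c) atTop atTop :=
      ((tendsto_rpow_atTop hc).comp tendsto_natCast_atTop_atTop).const_mul_atTop hC
    have h2 : Tendsto (fun n => 1 + e n) atTop (nhds 1) := by simpa using he.const_add 1
    exact h1.atTop_mul_pos one_pos h2
  have hvar : ∀ n, ∫ ω, (S n ω - m n) ^ 2 ∂μ ≤ m n := by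
    intro n
    rw [← variance_eq_integral (hSLp n).aemeasurable]
    refine variance_sum_le_integral_sum hmeas h01 fun i hi j hj hij => ?_
    rw [Finset.mem_Icc] at hi hj
    have h := (hNA n).integral_mul_le (fun i ω => h01 _ ω)
      (i := ⟨i - 1, by omega⟩) (j := ⟨j - 1, by omega⟩)
      (by simp only [ne_eq, Fin.mk.injEq]; omega)
    simpa only [Nat.sub_add_cancel hi.1, Nat.sub_add_cancel hj.1] using h
  have hex : ∀ k : ℕ, ∃ n, (k : ℝ) ^ 2 ≤ m n := fun k =>
    (hmt.eventually_ge_atTop ((k : ℝ) ^ 2)).exists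
  classical
  set t : ℕ → ℕ := fun k => Nat.find (hex k) with ht
  have htl : ∀ k : ℕ, (k : ℝ) ^ 2 ≤ m (t k) := fun k => Nat.find_spec (hex k)
  have htmin : ∀ k n : ℕ, (k : ℝ) ^ 2 ≤ m n → t k ≤ n := fun k n h => Nat.find_min' (hex k) h
  have htu : ∀ k : ℕ, m (t k) ≤ (k : ℝ) ^ 2 + 1 := by
    intro k
    rcases Nat.eq_zero_or_pos (t k) with h0 | hpos
    · rw [h0]
      have : m 0 = 0 := by simp [hm, hS]
      rw [this]
      positivity
    · obtain ⟨r, hr⟩ : ∃ r, t k = r + 1 := ⟨t k - 1, by omega⟩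
      have hlt : m r < (k : ℝ) ^ 2 := by
        by_contra! hge
        have := htmin k r hge
        omega
      rw [hr]
      linarith [hmsucc r]
  have hsummable : Summable fun k : ℕ =>
      ∫ ω, ((S (t k) ω - m (t k)) / (k : ℝ) ^ 2) ^ 2 ∂μ := by
    refine Summable.of_nonneg_of_le (fun k => integral_nonneg fun ω => sq_nonneg _) (fun k => ?_)
      ((Real.summable_one_div_nat_pow.2 one_lt_two).mul_left 2)
    simp_rw [div_pow, integral_div]
    rcases Nat.eq_zero_or_pos k with rfl | hk
    · simp
    · have hk1 : (1 : ℝ) ≤ k := by exact_mod_cast hk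
      rw [mul_one_div, div_le_div_iff₀ (by positivity) (by positivity)]
      have h1 : ∫ ω, (S (t k) ω - m (t k)) ^ 2 ∂μ ≤ 2 * (k : ℝ) ^ 2 := by
        nlinarith [hvar (t k), htu k]
      nlinarith [mul_le_mul_of_nonneg_right h1 (sq_nonneg (k : ℝ))]
  have hmk : Tendsto (fun k : ℕ => m (t k) / (k : ℝ) ^ 2) atTop (nhds 1) := by
    have hup : Tendsto (fun k : ℕ => 1 + 1 / (k : ℝ) ^ 2) atTop (nhds 1) := by
      have : Tendsto (fun k : ℕ => (k : ℝ) ^ 2) atTop atTop :=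
        (tendsto_pow_atTop two_ne_zero).comp tendsto_natCast_atTop_atTop
      simpa using this.inv_tendsto_atTop.const_add 1
    refine tendsto_of_tendsto_of_tendsto_of_le_of_le' tendsto_const_nhds hup ?_ ?_
    all_goals
      filter_upwards [eventually_gt_atTop 0] with k hk
      have hk0 : (0 : ℝ) < (k : ℝ) ^ 2 := by positivity
    · exact (one_le_div hk0).2 (htl k)
    · rw [div_le_iff₀ hk0, add_mul, one_div_mul_cancel hk0.ne']
      linarith [htu k]
  filter_upwards [ae_tendsto_zero_of_summable_integral
    (fun k => (((hSLp (t k)).sub (memLp_const (m (t k)))).integrable_sq.div_const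
      (((k : ℝ) ^ 2) ^ 2)).congr (ae_of_all _ fun ω => by simp [div_pow]))
    (fun k ω => sq_nonneg _) hsummable] with ω hω
  refine tendsto_div_of_tendsto_subseq_div_sq (hSmono ω) (fun n => hS0 n ω) hmmono hm0 hmt htl
    htmin ?_
  have h0 : Tendsto (fun k : ℕ => (S (t k) ω - m (t k)) / (k : ℝ) ^ 2) atTop (nhds 0) := by
    rw [tendsto_zero_iff_abs_tendsto_zero]
    simpa [Function.comp_def, Real.sqrt_sq_eq_abs] using hω.sqrt
  simpa [← add_div] using h0.add hmk
end

section
/- In the Pólya Web, for all λ₁, λ₂ ∈ Λ with ‖λ₁‖, ‖λ₂‖ ≥ 1 and λ₁ ⪰ λ₂, and every n ≥ max(‖λ₁‖, ‖λ₂‖), one has Z_{λ₁}(n) ≤ Z_{λ₂}(n), with equality if and only if S_{λ₁}(n) = S_{λ₂}(n). -/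
/-- The partial order `⪰` on `ℕ × ℕ`: `(k₁,l₁) ⪰ (k₂,l₂)` iff `k₁ ≤ k₂` and `l₁ ≥ l₂`. -/
def SuccEq (p q : ℕ × ℕ) : Prop := p.1 ≤ q.1 ∧ q.2 ≤ p.2

/-- `ψ(a,b) = a / (a + b)`, the ratio of the first coordinate to the sum. -/
noncomputable def polyaPsi (p : ℕ × ℕ) : ℝ := (p.1 : ℝ) / (p.1 + p.2)

theorem le_webNext (ω : (ℕ × ℕ) → Bool) (p : ℕ × ℕ) : p ≤ webNext ω p :=
  le_self_add

theorem webWalk_webNorm (ω : (ℕ × ℕ) → Bool) (l : ℕ × ℕ) : webWalk ω l (webNorm l) = l := by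
  simp [webWalk]

theorem webWalk_succ (ω : (ℕ × ℕ) → Bool) {l : ℕ × ℕ} {n : ℕ} (h : webNorm l ≤ n) :
    webWalk ω l (n + 1) = webNext ω (webWalk ω l n) := by
  rw [webWalk, Nat.succ_sub h, Function.iterate_succ_apply', webWalk]

theorem webNorm_webWalk (ω : (ℕ × ℕ) → Bool) {l : ℕ × ℕ} {n : ℕ} (h : webNorm l ≤ n) :
    webNorm (webWalk ω l n) = n := by
  induction n, h using Nat.le_induction with
  | base => rw [webWalk_webNorm]
  | succ n h ih => rw [webWalk_succ ω h, webNorm_webNext, ih]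

theorem le_webWalk (ω : (ℕ × ℕ) → Bool) (l : ℕ × ℕ) (n : ℕ) : l ≤ webWalk ω l n :=
  Function.id_le_iterate_of_id_le (le_webNext ω) _ l

theorem SuccEq.webNext {p q : ℕ × ℕ} (h : SuccEq p q) (hpq : webNorm p = webNorm q)
    (ω : (ℕ × ℕ) → Bool) : SuccEq (webNext ω p) (webNext ω q) := by
  by_cases he : p = q
  · subst he
    exact ⟨le_rfl, le_rfl⟩
  · obtain ⟨a, b⟩ := p
    obtain ⟨c, d⟩ := q
    simp only [SuccEq, webNorm, Prod.mk.injEq] at h hpq he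
    unfold SuccEq _root_.webNext webStep
    split_ifs <;> simp <;> omega

/-- Two walks started in the order `⪰` keep this order once both have started. -/
theorem SuccEq.webWalk {l₁ l₂ : ℕ × ℕ} (h : SuccEq l₁ l₂) (ω : (ℕ × ℕ) → Bool) {n : ℕ}
    (hn : max (webNorm l₁) (webNorm l₂) ≤ n) : SuccEq (webWalk ω l₁ n) (webWalk ω l₂ n) := by
  induction n, hn using Nat.le_induction with
  | base =>
    rcases le_total (webNorm l₁) (webNorm l₂) with hle | hle
    · rw [max_eq_right hle, webWalk_webNorm]
      have hnorm := webNorm_webWalk ω hle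
      have hmono := (le_webWalk ω l₁ (webNorm l₂)).2
      unfold SuccEq webNorm at *
      omega
    · rw [max_eq_left hle, webWalk_webNorm]
      have hnorm := webNorm_webWalk ω hle
      have hmono := (le_webWalk ω l₂ (webNorm l₁)).1
      unfold SuccEq webNorm at *
      omega
  | succ n hn ih =>
    obtain ⟨hn₁, hn₂⟩ := max_le_iff.mp hn
    rw [webWalk_succ ω hn₁, webWalk_succ ω hn₂]
    exact ih.webNext (by rw [webNorm_webWalk ω hn₁, webNorm_webWalk ω hn₂]) ω

theorem polyaPsi_eq_div_webNorm (p : ℕ × ℕ) : polyaPsi p = (p.1 : ℝ) / (webNorm p : ℝ) := by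
  rw [polyaPsi, webNorm, Nat.cast_add]

/-- In the Pólya Web, for `λ₁ ⪰ λ₂` with `‖λ₁‖, ‖λ₂‖ ≥ 1` and any
`n ≥ max (‖λ₁‖, ‖λ₂‖)`, one has `Z_{λ₁}(n) ≤ Z_{λ₂}(n)`, with equality iff
`S_{λ₁}(n) = S_{λ₂}(n)`.  (Here `Z_λ(n) = ψ(S_λ(n))`; the statement holds for every
realization `ω` of the web.) -/
theorem polya_ratio_monotone (ω : (ℕ × ℕ) → Bool) (l₁ l₂ : ℕ × ℕ)
    (h₁ : 1 ≤ webNorm l₁) (h₂ : 1 ≤ webNorm l₂) (hord : SuccEq l₁ l₂)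
    (n : ℕ) (hn : max (webNorm l₁) (webNorm l₂) ≤ n) :
    polyaPsi (webWalk ω l₁ n) ≤ polyaPsi (webWalk ω l₂ n) ∧
      (polyaPsi (webWalk ω l₁ n) = polyaPsi (webWalk ω l₂ n) ↔
        webWalk ω l₁ n = webWalk ω l₂ n) := by
  obtain ⟨hn₁, hn₂⟩ := max_le_iff.mp hn
  have hfst := (hord.webWalk ω hn).1
  have hnorm₁ := webNorm_webWalk ω hn₁
  have hnorm₂ := webNorm_webWalk ω hn₂
  have hpos : (0 : ℝ) < n := by exact_mod_cast h₁.trans hn₁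
  rw [polyaPsi_eq_div_webNorm, polyaPsi_eq_div_webNorm, hnorm₁, hnorm₂]
  refine ⟨by gcongr, fun he => ?_, fun he => by rw [he]⟩
  rw [div_left_inj' hpos.ne', Nat.cast_inj] at he
  unfold webNorm at hnorm₁ hnorm₂
  exact Prod.ext he (by omega)
end

section
/- For every ε > 0, with n₁ = ⌈ε√n⌉ and n₂ = n − ⌈ε√n⌉, one has lim_{n→∞} (1/√n) · Σ_{k=n₁}^{n₂} binom(n−1, k)² · binom(2(n−1), 2k)^{−1} = √π. -/
open Filter

/-- The central binomial coefficient `2k choose k`, normalised by `4 ^ k`. -/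
noncomputable def normCentralBinom (k : ℕ) : ℝ := (k.centralBinom : ℝ) / 4 ^ k

lemma normCentralBinom_zero : normCentralBinom 0 = 1 := by simp [normCentralBinom]

lemma normCentralBinom_pos (k : ℕ) : 0 < normCentralBinom k :=
  div_pos (by exact_mod_cast k.centralBinom_pos) (by positivity)

lemma succ_mul_normCentralBinom_succ (k : ℕ) :
    ((k : ℝ) + 1) * normCentralBinom (k + 1) = (k + 1 / 2) * normCentralBinom k := by
  have h : ((k : ℝ) + 1) * (k + 1).centralBinom = 2 * (2 * k + 1) * k.centralBinom := by
    exact_mod_cast k.succ_mul_centralBinom_succ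
  unfold normCentralBinom
  rw [pow_succ]
  field_simp
  linear_combination 2 * h

lemma normCentralBinom_succ (k : ℕ) :
    normCentralBinom (k + 1) = (k + 1 / 2) / (k + 1) * normCentralBinom k := by
  rw [div_mul_eq_mul_div, eq_div_iff (by positivity), mul_comm]
  exact succ_mul_normCentralBinom_succ k

lemma normCentralBinom_sq_mul_le_one (k : ℕ) : normCentralBinom k ^ 2 * (2 * k + 1) ≤ 1 := by
  induction k with
  | zero => simp [normCentralBinom_zero]
  | succ k ih =>
    refine le_trans ?_ ih
    rw [normCentralBinom_succ, mul_pow, mul_comm (_ ^ 2) (_ ^ 2), mul_assoc]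
    gcongr
    rw [div_pow, div_mul_eq_mul_div, div_le_iff₀ (by positivity)]
    push_cast
    nlinarith [(Nat.cast_nonneg k : (0 : ℝ) ≤ k)]

lemma one_le_normCentralBinom_sq_mul (k : ℕ) : 1 ≤ normCentralBinom k ^ 2 * (4 * k + 1) := by
  induction k with
  | zero => simp [normCentralBinom_zero]
  | succ k ih =>
    refine le_trans ih ?_
    rw [normCentralBinom_succ, mul_pow, mul_comm (_ ^ 2) (_ ^ 2), mul_assoc]
    gcongr
    rw [div_pow, div_mul_eq_mul_div, le_div_iff₀ (by positivity)]
    push_cast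
    nlinarith [(Nat.cast_nonneg k : (0 : ℝ) ≤ k)]

lemma normCentralBinom_le_two_mul {j m : ℕ} (h : m ≤ 2 * j) :
    normCentralBinom j ≤ 2 * normCentralBinom m := by
  have hm := (normCentralBinom_pos m).le
  refine abs_le_of_sq_le_sq' ?_ (by positivity) |>.2
  have h1 := normCentralBinom_sq_mul_le_one j
  have h2 := one_le_normCentralBinom_sq_mul m
  have h3 : (m : ℝ) ≤ 2 * j := by exact_mod_cast h
  have h4 : normCentralBinom j ^ 2 * (m + 1) ≤ (2 * normCentralBinom m) ^ 2 * (m + 1) := by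
    nlinarith [sq_nonneg (normCentralBinom j), sq_nonneg (normCentralBinom m)]
  exact le_of_mul_le_mul_right h4 (by positivity)

lemma sum_range_normCentralBinom (N : ℕ) :
    ∑ k ∈ Finset.range N, normCentralBinom k = 2 * N * normCentralBinom N := by
  induction N with
  | zero => simp
  | succ N ih =>
    rw [Finset.sum_range_succ, ih]
    push_cast
    linear_combination -2 * succ_mul_normCentralBinom_succ N

lemma sum_range_normCentralBinom_le (N : ℕ) :
    ∑ k ∈ Finset.range N, normCentralBinom k ≤ 2 * √N := by
  rw [sum_range_normCentralBinom, mul_assoc]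
  gcongr
  refine Real.le_sqrt_of_sq_le ?_
  have h := normCentralBinom_sq_mul_le_one N
  have hN : (0 : ℝ) ≤ N := Nat.cast_nonneg N
  nlinarith [mul_nonneg hN (sq_nonneg (normCentralBinom N)), mul_le_mul_of_nonneg_left h hN]

/-- The coefficients of `(1 - x)⁻¹ = (1 - x) ^ (-1/2) * (1 - x) ^ (-1/2)`. -/
lemma sum_range_normCentralBinom_mul (m : ℕ) :
    ∑ k ∈ Finset.range (m + 1), normCentralBinom k * normCentralBinom (m - k) = 1 := by
  have symm (m : ℕ) :
      2 * ∑ k ∈ Finset.range (m + 1), (k : ℝ) * (normCentralBinom k * normCentralBinom (m - k)) =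
      m * ∑ k ∈ Finset.range (m + 1), normCentralBinom k * normCentralBinom (m - k) := by
    rw [two_mul]
    nth_rw 1 [← Finset.sum_range_reflect]
    rw [← Finset.sum_add_distrib, Finset.mul_sum]
    refine Finset.sum_congr rfl fun k hk => ?_
    have hk' : k ≤ m := Nat.lt_succ_iff.1 (Finset.mem_range.1 hk)
    rw [Nat.add_sub_cancel, Nat.sub_sub_self hk', Nat.cast_sub hk']
    ring
  induction m with
  | zero => simp [normCentralBinom_zero]
  | succ m ih =>
    have h1 := symm (m + 1)
    have h2 := symm m
    rw [Finset.sum_range_succ'] at h1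
    have h3 : ∑ k ∈ Finset.range (m + 1), ((k + 1 : ℕ) : ℝ) *
        (normCentralBinom (k + 1) * normCentralBinom (m + 1 - (k + 1))) =
        ∑ k ∈ Finset.range (m + 1), (k : ℝ) * (normCentralBinom k * normCentralBinom (m - k)) +
        1 / 2 * ∑ k ∈ Finset.range (m + 1), normCentralBinom k * normCentralBinom (m - k) := by
      rw [Finset.mul_sum, ← Finset.sum_add_distrib]
      refine Finset.sum_congr rfl fun k _ => ?_
      rw [Nat.add_sub_add_right]
      push_cast
      linear_combination normCentralBinom (m - k) * succ_mul_normCentralBinom_succ k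
    rw [h3, ih] at h1
    rw [ih] at h2
    have hm : ((m : ℝ) + 1) ≠ 0 := by positivity
    push_cast at h1
    apply mul_left_cancel₀ hm
    linear_combination -h1 + h2

lemma choose_sq_div_choose_eq {m k : ℕ} (h : k ≤ m) :
    (m.choose k : ℝ) ^ 2 / ((2 * m).choose (2 * k) : ℝ) =
      normCentralBinom k * normCentralBinom (m - k) / normCentralBinom m := by
  obtain ⟨j, rfl⟩ := Nat.exists_eq_add_of_le h
  have central (i : ℕ) : ((i.centralBinom : ℕ) : ℝ) =
      ((2 * i).factorial : ℝ) / (i.factorial * i.factorial) := by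
    rw [Nat.centralBinom_eq_two_mul_choose, Nat.cast_choose ℝ (by omega), two_mul,
      Nat.add_sub_cancel]
  have hf (i : ℕ) : (i.factorial : ℝ) ≠ 0 := by exact_mod_cast i.factorial_ne_zero
  have h1 := hf k
  have h2 := hf j
  have h3 := hf (k + j)
  have h4 := hf (2 * k)
  have h5 := hf (2 * j)
  have h6 := hf (2 * (k + j))
  unfold normCentralBinom
  rw [Nat.add_sub_cancel_left, central, central, central, Nat.cast_choose ℝ h,
    Nat.cast_choose ℝ (by omega : 2 * k ≤ 2 * (k + j)), Nat.add_sub_cancel_left,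
    show 2 * (k + j) - 2 * k = 2 * j by omega, pow_add]
  field_simp

lemma normCentralBinom_sq_mul_W (m : ℕ) :
    normCentralBinom m ^ 2 * (2 * m + 1) * Real.Wallis.W m = 1 := by
  induction m with
  | zero => simp [normCentralBinom_zero, Real.Wallis.W]
  | succ m ih =>
    refine Eq.trans ?_ ih
    rw [normCentralBinom_succ, Real.Wallis.W_succ]
    push_cast
    field_simp
    ring

lemma tendsto_inv_sqrt_mul_normCentralBinom :
    Tendsto (fun m : ℕ => 1 / √((m + 1 : ℕ) : ℝ) * (1 / normCentralBinom m)) atTop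
      (nhds √Real.pi) := by
  have h : Tendsto (fun m : ℕ => √(Real.Wallis.W m * (2 - 1 / ((m : ℝ) + 1)))) atTop
      (nhds √(Real.pi / 2 * (2 - 0))) :=
    (Real.Wallis.tendsto_W_nhds_pi_div_two.mul
      (tendsto_one_div_add_atTop_nhds_zero_nat.const_sub 2)).sqrt
  rw [show Real.pi / 2 * (2 - 0) = Real.pi by ring] at h
  refine h.congr fun m => ?_
  have hp := normCentralBinom_pos m
  have hW := normCentralBinom_sq_mul_W m
  rw [Real.sqrt_eq_iff_mul_self_eq_of_pos (by positivity)]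
  have hs : √((m + 1 : ℕ) : ℝ) ^ 2 = (m : ℝ) + 1 := by
    rw [Real.sq_sqrt (by positivity)]
    push_cast
    rfl
  have hs0 : 0 < √((m + 1 : ℕ) : ℝ) := by positivity
  field_simp
  rw [hs]
  linear_combination -((m : ℝ) + 1) * hW

/-- Cutting `N` terms off the lower end and `N - 1` off the upper end of the full sum. -/
lemma sum_Icc_normCentralBinom_bounds {m N : ℕ} (hN : 1 ≤ N) (h : 2 * N ≤ m) :
    |∑ k ∈ Finset.Icc N (m + 1 - N),
        normCentralBinom k * normCentralBinom (m - k) / normCentralBinom m -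
      1 / normCentralBinom m| ≤ 8 * √N := by
  set t : ℕ → ℝ := fun k => normCentralBinom k * normCentralBinom (m - k) / normCentralBinom m
    with ht
  have t_nonneg (k : ℕ) : 0 ≤ t k :=
    div_nonneg (mul_pos (normCentralBinom_pos _) (normCentralBinom_pos _)).le
      (normCentralBinom_pos _).le
  have lower_le : ∑ k ∈ Finset.range N, t k ≤ 4 * √N := by
    calc ∑ k ∈ Finset.range N, t k ≤ ∑ k ∈ Finset.range N, 2 * normCentralBinom k := by
          refine Finset.sum_le_sum fun k hk => ?_
          have hk' := Finset.mem_range.1 hk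
          rw [ht, div_le_iff₀ (normCentralBinom_pos m)]
          nlinarith [normCentralBinom_pos k,
            normCentralBinom_le_two_mul (by omega : m ≤ 2 * (m - k))]
      _ ≤ 4 * √N := by
          rw [← Finset.mul_sum]
          linarith [sum_range_normCentralBinom_le N]
  have upper_le : ∑ k ∈ Finset.Ico (m + 2 - N) (m + 1), t k ≤ 4 * √N := by
    refine le_trans ?_ lower_le
    calc ∑ k ∈ Finset.Ico (m + 2 - N) (m + 1), t k
        = ∑ k ∈ Finset.Ico (m + 2 - N) (m + 1), t (m - k) := by
          refine Finset.sum_congr rfl fun k hk => ?_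
          have hk' := Finset.mem_Ico.1 hk
          simp only [ht]
          rw [Nat.sub_sub_self (by omega), mul_comm]
      _ = ∑ k ∈ Finset.Ico (m + 1 - (m + 1)) (m + 1 - (m + 2 - N)), t k :=
          Finset.sum_Ico_reflect t _ le_rfl
      _ ≤ ∑ k ∈ Finset.range N, t k := by
          refine Finset.sum_le_sum_of_subset_of_nonneg (fun k hk => ?_) fun k _ _ => t_nonneg k
          simp only [Finset.mem_Ico, Finset.mem_range] at hk ⊢
          omega
  have total : ∑ k ∈ Finset.range (m + 1), t k = 1 / normCentralBinom m := by
    rw [ht, ← Finset.sum_div, sum_range_normCentralBinom_mul]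
  have hIcc : Finset.Icc N (m + 1 - N) = Finset.Ico N (m + 2 - N) := by
    ext k
    simp only [Finset.mem_Icc, Finset.mem_Ico]
    omega
  rw [Finset.range_eq_Ico, ← Finset.sum_Ico_consecutive t (Nat.zero_le N) (by omega : N ≤ m + 1),
    ← Finset.sum_Ico_consecutive t (by omega : N ≤ m + 2 - N) (by omega : m + 2 - N ≤ m + 1),
    ← Finset.range_eq_Ico] at total
  have h1 := Finset.sum_nonneg fun k (_ : k ∈ Finset.range N) => t_nonneg k
  have h2 := Finset.sum_nonneg fun k (_ : k ∈ Finset.Ico (m + 2 - N) (m + 1)) => t_nonneg k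
  rw [hIcc, ← total, abs_le]
  constructor <;> linarith [Real.sqrt_nonneg (N : ℝ)]

/-- For every `ε > 0`, with `n₁ = ⌈ε√n⌉` and `n₂ = n - ⌈ε√n⌉`,
`lim_{n→∞} (1/√n) ∑_{k=n₁}^{n₂} (n-1 choose k)² / (2(n-1) choose 2k) = √π`. -/
theorem hypergeometric_sum_limit (ε : ℝ) (hε : 0 < ε) :
    Tendsto (fun n : ℕ =>
      (1 / Real.sqrt n) *
        ∑ k ∈ Finset.Icc ⌈ε * Real.sqrt n⌉₊ (n - ⌈ε * Real.sqrt n⌉₊),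
          ((n - 1).choose k : ℝ) ^ 2 / ((2 * (n - 1)).choose (2 * k) : ℝ))
      atTop (nhds (Real.sqrt Real.pi)) := by
  rw [← tendsto_add_atTop_iff_nat 1]
  have hsqrt : Tendsto (fun m : ℕ => √((m + 1 : ℕ) : ℝ)) atTop atTop :=
    Real.tendsto_sqrt_atTop.comp
      (tendsto_natCast_atTop_atTop.comp (tendsto_add_atTop_nat 1))
  have herr : Tendsto (fun m : ℕ => 8 * √(ε + 1) / √√((m + 1 : ℕ) : ℝ)) atTop (nhds 0) :=
    tendsto_const_nhds.div_atTop (Real.tendsto_sqrt_atTop.comp hsqrt)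
  refine tendsto_inv_sqrt_mul_normCentralBinom.congr_dist
    (squeeze_zero' (Eventually.of_forall fun _ => dist_nonneg) ?_ herr)
  filter_upwards [hsqrt.eventually_ge_atTop (2 * (ε + 1) + 1)] with m hm
  set s := √((m + 1 : ℕ) : ℝ) with hs
  set N := ⌈ε * s⌉₊ with hN
  have hs1 : 1 ≤ s := by linarith
  have hss : s ^ 2 = (m : ℝ) + 1 := by
    rw [hs, Real.sq_sqrt (by positivity)]
    push_cast
    rfl
  have hN1 : 1 ≤ N := Nat.one_le_ceil_iff.2 (by positivity)
  have hNs : (N : ℝ) ≤ (ε + 1) * s := by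
    have := (Nat.ceil_lt_add_one (by positivity : 0 ≤ ε * s)).le
    linarith
  have hNm : 2 * N ≤ m := by
    have : (2 * N : ℝ) ≤ m := by nlinarith
    exact_mod_cast this
  have hsum : ∑ k ∈ Finset.Icc N (m + 1 - N),
      ((m + 1 - 1).choose k : ℝ) ^ 2 / ((2 * (m + 1 - 1)).choose (2 * k) : ℝ) =
      ∑ k ∈ Finset.Icc N (m + 1 - N),
        normCentralBinom k * normCentralBinom (m - k) / normCentralBinom m := by
    refine Finset.sum_congr rfl fun k hk => ?_
    have hk' := Finset.mem_Icc.1 hk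
    exact choose_sq_div_choose_eq (by omega)
  rw [hsum, dist_comm, Real.dist_eq, ← mul_sub, abs_mul, abs_of_nonneg (by positivity)]
  calc 1 / s * _ ≤ 1 / s * (8 * √N) := by
        gcongr
        exact sum_Icc_normCentralBinom_bounds hN1 hNm
    _ ≤ 1 / s * (8 * (√(ε + 1) * √s)) := by
        gcongr
        rw [← Real.sqrt_mul (by positivity)]
        exact Real.sqrt_le_sqrt hNs
    _ = 8 * √(ε + 1) / √s := by
        have h0 : 0 < √s := by positivity
        have h1 : √s ^ 2 = s := Real.sq_sqrt (by positivity)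
        nth_rw 1 [← h1]
        field_simp
end

section
/- For every integer k ≥ 1, ∫_0^∞ ∫_0^y ( g_k(x)·g_{k+1}(y) − g_k(y)·g_{k+1}(x) ) dx dy = binom(2k, k) / 4^k, where g_j(x) = x^{j−1}e^{−x}/(j−1)! is the Gamma(j,1) density. (This is the probability that two coalescing Yule Walks started from adjacent levels k and k+1 at the same time never meet, and equals the probability that a simple symmetric random walk returns to its starting point in exactly 2k steps.) -/
open MeasureTheory

/-- The density of the `Gamma(j,1)` distribution, `g_j(x) = x^{j-1} e^{-x} / (j-1)!`
on `(0,∞)`. -/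
noncomputable def gammaDens (j : ℕ) (x : ℝ) : ℝ :=
  x ^ (j - 1) * Real.exp (-x) / (j - 1).factorial

theorem integral_Ioi_pow_mul_exp_neg_mul (n : ℕ) {a : ℝ} (ha : 0 < a) :
    ∫ x in Set.Ioi (0 : ℝ), x ^ n * Real.exp (-(a * x)) = n.factorial / a ^ (n + 1) := by
  have h := Real.integral_rpow_mul_exp_neg_mul_Ioi (a := n + 1) (by positivity) ha
  rw [Real.Gamma_nat_eq_factorial] at h
  simp only [add_sub_cancel_right, Real.rpow_natCast] at h
  rw [h, ← Nat.cast_add_one, Real.rpow_natCast, one_div, inv_pow]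
  field_simp

theorem integrableOn_Ioi_pow_mul_exp_neg_mul (n : ℕ) {a : ℝ} (ha : 0 < a) :
    IntegrableOn (fun x : ℝ => x ^ n * Real.exp (-(a * x))) (Set.Ioi 0) := by
  by_contra h
  have h0 := integral_Ioi_pow_mul_exp_neg_mul n ha
  rw [integral_undef h] at h0
  have : (0 : ℝ) < n.factorial / a ^ (n + 1) := by positivity
  linarith

theorem continuous_gammaDens (j : ℕ) : Continuous (gammaDens j) := by
  unfold gammaDens
  fun_prop

theorem gammaDens_nonneg (j : ℕ) {x : ℝ} (hx : 0 ≤ x) : 0 ≤ gammaDens j x := by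
  unfold gammaDens
  positivity

theorem integrableOn_gammaDens (j : ℕ) : IntegrableOn (gammaDens j) (Set.Ioi 0) := by
  have h := (integrableOn_Ioi_pow_mul_exp_neg_mul (j - 1) one_pos).div_const
    ((j - 1).factorial : ℝ)
  simp only [one_mul] at h
  exact h

theorem tendsto_gammaDens_atTop (j : ℕ) :
    Filter.Tendsto (gammaDens j) Filter.atTop (nhds 0) := by
  have h := (Real.tendsto_pow_mul_exp_neg_atTop_nhds_zero (j - 1)).div_const
    ((j - 1).factorial : ℝ)
  rwa [zero_div] at h

theorem hasDerivAt_gammaDens_succ {k : ℕ} (hk : 1 ≤ k) (x : ℝ) :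
    HasDerivAt (gammaDens (k + 1)) (gammaDens k x - gammaDens (k + 1) x) x := by
  obtain ⟨n, rfl⟩ := Nat.exists_eq_add_of_le' hk
  have h := ((hasDerivAt_pow (n + 1) x).mul (hasDerivAt_neg x).exp).div_const
    ((n + 1).factorial : ℝ)
  refine h.congr_deriv ?_
  simp only [gammaDens, Nat.add_sub_cancel, Nat.factorial_succ]
  push_cast
  field_simp
  ring

theorem gammaDens_succ_zero {k : ℕ} (hk : 1 ≤ k) : gammaDens (k + 1) 0 = 0 := by
  simp [gammaDens, Nat.one_le_iff_ne_zero.mp hk]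

theorem intervalIntegral_gammaDens_succ {k : ℕ} (hk : 1 ≤ k) (y : ℝ) :
    ∫ x in (0 : ℝ)..y, gammaDens (k + 1) x =
      (∫ x in (0 : ℝ)..y, gammaDens k x) - gammaDens (k + 1) y := by
  have hi : ∀ j, IntervalIntegrable (gammaDens j) volume 0 y := fun j =>
    (continuous_gammaDens j).intervalIntegrable 0 y
  have h := intervalIntegral.integral_eq_sub_of_hasDerivAt
    (fun x _ => hasDerivAt_gammaDens_succ hk x) ((hi k).sub (hi (k + 1)))
  rw [intervalIntegral.integral_sub (hi k) (hi (k + 1)), gammaDens_succ_zero hk] at h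
  linarith

theorem gammaDens_mul_gammaDens_succ {k : ℕ} (hk : 1 ≤ k) (x : ℝ) :
    gammaDens k x * gammaDens (k + 1) x =
      x ^ (2 * k - 1) * Real.exp (-(2 * x)) / ((k - 1).factorial * k.factorial) := by
  obtain ⟨n, rfl⟩ := Nat.exists_eq_add_of_le' hk
  have he : Real.exp (-(2 * x)) = Real.exp (-x) * Real.exp (-x) := by
    rw [← Real.exp_add]
    ring_nf
  have hn : 2 * (n + 1) - 1 = n + (n + 1) := by omega
  simp only [gammaDens, Nat.add_sub_cancel, hn, he, pow_add]
  field_simp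

theorem integrableOn_gammaDens_mul_succ {k : ℕ} (hk : 1 ≤ k) :
    IntegrableOn (fun x => gammaDens k x * gammaDens (k + 1) x) (Set.Ioi 0) := by
  simp only [gammaDens_mul_gammaDens_succ hk]
  exact (integrableOn_Ioi_pow_mul_exp_neg_mul _ two_pos).div_const _

theorem two_mul_integral_gammaDens_mul_succ {k : ℕ} (hk : 1 ≤ k) :
    2 * ∫ x in Set.Ioi (0 : ℝ), gammaDens k x * gammaDens (k + 1) x =
      ((2 * k).choose k : ℝ) / 4 ^ k := by
  simp only [gammaDens_mul_gammaDens_succ hk]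
  rw [integral_div, integral_Ioi_pow_mul_exp_neg_mul _ two_pos,
    Nat.cast_choose ℝ (by omega : k ≤ 2 * k)]
  obtain ⟨n, rfl⟩ := Nat.exists_eq_add_of_le' hk
  have h1 : 2 * (n + 1) - (n + 1) = n + 1 := by omega
  have h2 : 2 * (n + 1) - 1 = 2 * n + 1 := by omega
  have h3 : 2 * (n + 1) = (2 * n + 1) + 1 := by ring
  have h4 : (4 : ℝ) ^ (n + 1) = 2 ^ (2 * n + 1 + 1) := by
    rw [← h3, pow_mul]
    norm_num
  rw [h1, h2, h4, h3, Nat.factorial_succ (2 * n + 1), Nat.add_sub_cancel, Nat.factorial_succ n]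
  push_cast
  field_simp
  ring

theorem integrableOn_intervalIntegral_mul_gammaDens (i j : ℕ) :
    IntegrableOn (fun y => (∫ x in (0 : ℝ)..y, gammaDens i x) * gammaDens j y)
      (Set.Ioi 0) := by
  refine Integrable.bdd_mul (c := ∫ x in Set.Ioi (0 : ℝ), gammaDens i x)
    (integrableOn_gammaDens j) ?_ ?_
  · exact (intervalIntegral.continuous_primitive
      (fun a b => (continuous_gammaDens i).intervalIntegrable a b) 0).aestronglyMeasurable
  · refine (ae_restrict_iff' measurableSet_Ioi).2 (.of_forall fun y (hy : 0 < y) => ?_)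
    rw [Real.norm_of_nonneg (intervalIntegral.integral_nonneg hy.le
      fun x hx => gammaDens_nonneg i hx.1), intervalIntegral.integral_of_le hy.le]
    exact setIntegral_mono_set (integrableOn_gammaDens i)
      ((ae_restrict_iff' measurableSet_Ioi).2
        (.of_forall fun x (hx : 0 < x) => gammaDens_nonneg i hx.le))
      (Set.Ioc_subset_Ioi_self.eventuallyLE)

/-- For every `k ≥ 1`,
`∫_0^∞ ∫_0^y (g_k(x) g_{k+1}(y) - g_k(y) g_{k+1}(x)) dx dy = (2k choose k) / 4^k`. -/
theorem yule_never_meet_prob (k : ℕ) (hk : 1 ≤ k) :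
    (∫ y in Set.Ioi (0 : ℝ), ∫ x in Set.Ioo (0 : ℝ) y,
        (gammaDens k x * gammaDens (k + 1) y - gammaDens k y * gammaDens (k + 1) x)) =
      ((2 * k).choose k : ℝ) / 4 ^ k := by
  set G : ℝ → ℝ := fun y => ∫ x in (0 : ℝ)..y, gammaDens k x with hG
  set D : ℝ → ℝ := fun y => gammaDens k y * gammaDens (k + 1) y +
    G y * (gammaDens k y - gammaDens (k + 1) y) with hD
  have hderiv : ∀ y, HasDerivAt (fun y => G y * gammaDens (k + 1) y) (D y) y := fun y =>
    ((continuous_gammaDens k).integral_hasStrictDerivAt 0 y).hasDerivAt.mul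
      (hasDerivAt_gammaDens_succ hk y)
  have hprod := integrableOn_gammaDens_mul_succ hk
  have hDint : IntegrableOn D (Set.Ioi 0) := by
    simp only [hD, mul_sub]
    exact hprod.add ((integrableOn_intervalIntegral_mul_gammaDens k k).sub
      (integrableOn_intervalIntegral_mul_gammaDens k (k + 1)))
  have hlim : Filter.Tendsto (fun y => G y * gammaDens (k + 1) y) Filter.atTop (nhds 0) := by
    simpa using (intervalIntegral_tendsto_integral_Ioi 0 (integrableOn_gammaDens k)
      Filter.tendsto_id).mul (tendsto_gammaDens_atTop (k + 1))
  have hDzero : ∫ y in Set.Ioi (0 : ℝ), D y = 0 := by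
    rw [integral_Ioi_of_hasDerivAt_of_tendsto' (fun y _ => hderiv y) hDint hlim]
    simp [gammaDens_succ_zero hk]
  have hinner : ∀ y ∈ Set.Ioi (0 : ℝ), (∫ x in Set.Ioo (0 : ℝ) y,
      (gammaDens k x * gammaDens (k + 1) y - gammaDens k y * gammaDens (k + 1) x)) =
        2 * (gammaDens k y * gammaDens (k + 1) y) - D y := by
    intro y hy
    have hi : ∀ j, IntervalIntegrable (gammaDens j) volume 0 y := fun j =>
      (continuous_gammaDens j).intervalIntegrable 0 y
    rw [← integral_Ioc_eq_integral_Ioo, ← intervalIntegral.integral_of_le (le_of_lt hy),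
      intervalIntegral.integral_sub ((hi k).mul_const _) ((hi (k + 1)).const_mul _),
      intervalIntegral.integral_mul_const, intervalIntegral.integral_const_mul,
      intervalIntegral_gammaDens_succ hk]
    simp only [hD, hG]
    ring
  rw [setIntegral_congr_fun measurableSet_Ioi hinner,
    integral_sub (hprod.const_mul 2) hDint, hDzero, sub_zero, integral_const_mul,
    two_mul_integral_gammaDens_mul_succ hk]
end
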